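/- Let d ≥ 1 and d+2 ≥ q > p > 1. Then there exists a constant N = N(d, p, q) such that for every measurable b on ℝ^{d+1} with ‖b‖_{E_{q,1}} < ∞ and every measurable f ≥ 0 on ℝ^{d+1}, one has ∫_{ℝ^{d+1}} |b|^p (P_1 f)^p dz ≤ N ‖b‖_{E_{q,1}}^p ‖f‖_{L_p(ℝ^{d+1})}^p. -/

import Mathlib

open MeasureTheory Set ENNReal Filter

noncomputable section

/-- Euclidean space `ℝ^d`. -/
abbrev Ed (d : ℕ) := EuclideanSpace ℝ (Fin d)

/-- Points of `ℝ^{d+1}`: `z = (t, x)`. -/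
abbrev Pt (d : ℕ) := ℝ × Ed d

/-- The parabolic cylinder `C_ρ(t,x)`. -/
def pCyl (d : ℕ) (ρ : ℝ) (z : Pt d) : Set (Pt d) :=
  {w | dist z.2 w.2 < ρ ∧ z.1 ≤ w.1 ∧ w.1 < z.1 + ρ ^ 2}

/-- The average `⨍_{C_ρ(z)} f`. -/
def pAvg (d : ℕ) (ρ : ℝ) (z : Pt d) (f : Pt d → ℝ≥0∞) : ℝ≥0∞ :=
  (volume (pCyl d ρ z))⁻¹ * ∫⁻ w in pCyl d ρ z, f w

/-- The fractional maximal function `M_β f`. -/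
def Mbeta (d : ℕ) (β : ℝ) (f : Pt d → ℝ≥0∞) (z : Pt d) : ℝ≥0∞ :=
  ⨆ (ρ : ℝ) (_ : 0 < ρ), ENNReal.ofReal (ρ ^ β) * pAvg d ρ z f

/-- The kernel `p_α(s, r)`. -/
def pKer (d : ℕ) (α : ℝ) (s r : ℝ) : ℝ≥0∞ :=
  if 0 < s then ENNReal.ofReal (s ^ (-(((d : ℝ) + 2 - α) / 2)) * Real.exp (-(r ^ 2) / s)) else 0

/-- The parabolic potential `P_α f`. -/
def Palpha (d : ℕ) (α : ℝ) (f : Pt d → ℝ≥0∞) (z : Pt d) : ℝ≥0∞ :=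
  ∫⁻ w : Pt d, pKer d α w.1 ‖w.2‖ * f (z.1 + w.1, z.2 + w.2)

/-- The parabolic Morrey norm `‖f‖_{E_{p,β}(Q)}`. -/
def MorreyNorm (d : ℕ) (p β : ℝ) (Q : Set (Pt d)) (f : Pt d → ℝ≥0∞) : ℝ≥0∞ :=
  ⨆ (ρ : ℝ) (_ : 0 < ρ) (z : Pt d) (_ : z ∈ Q),
    ENNReal.ofReal (ρ ^ β) * (pAvg d ρ z fun w => Q.indicator f w ^ p) ^ (1 / p)

/-- The `L_p`-norm on `ℝ^{d+1}`. -/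
def LpNormE (d : ℕ) (p : ℝ) (f : Pt d → ℝ≥0∞) : ℝ≥0∞ :=
  (∫⁻ z : Pt d, f z ^ p) ^ (1 / p)

/-- The mixed norm `‖f‖_{L_{q₁,q₂}}`. -/
def MixedNorm (d : ℕ) (q₁ q₂ : ℝ) (f : Pt d → ℝ≥0∞) : ℝ≥0∞ :=
  (∫⁻ t : ℝ, (∫⁻ x : Ed d, f (t, x) ^ q₁) ^ (q₂ / q₁)) ^ (1 / q₂)

/-- The normalized mixed norm `‖f‖_{L_{q₁,q₂}(Γ)}`. -/
def MixedNormOn (d : ℕ) (q₁ q₂ : ℝ) (Γ : Set (Pt d)) (f : Pt d → ℝ≥0∞) : ℝ≥0∞ :=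
  (MixedNorm d q₁ q₂ (Γ.indicator 1))⁻¹ * MixedNorm d q₁ q₂ (Γ.indicator f)

/-- The mixed-norm parabolic Morrey norm `‖f‖_{E_{q₁,q₂,β}(Q)}`. -/
def MixedMorrey (d : ℕ) (q₁ q₂ β : ℝ) (Q : Set (Pt d)) (f : Pt d → ℝ≥0∞) : ℝ≥0∞ :=
  ⨆ (ρ : ℝ) (_ : 0 < ρ) (z : Pt d) (_ : z ∈ Q),
    ENNReal.ofReal (ρ ^ β) * MixedNormOn d q₁ q₂ (pCyl d ρ z) (Q.indicator f)

/-- The symmetric parabolic maximal function `M̂ f`. -/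
def pMax (d : ℕ) (f : Pt d → ℝ≥0∞) (z : Pt d) : ℝ≥0∞ :=
  ⨆ (r : ℝ) (_ : 0 < r) (w : Pt d) (_ : z ∈ pCyl d r w), pAvg d r w f

/-- The time derivative `∂_t u`. -/
def timeDeriv (d : ℕ) (u : Pt d → ℝ) (z : Pt d) : ℝ :=
  fderiv ℝ u z ((1 : ℝ), (0 : Ed d))

/-- The spatial partial derivative `D_i u`. -/
def spDeriv (d : ℕ) (i : Fin d) (u : Pt d → ℝ) (z : Pt d) : ℝ :=
  fderiv ℝ u z ((0 : ℝ), EuclideanSpace.single i (1 : ℝ))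

/-- The Euclidean norm of the spatial gradient `|Du|`. -/
def gradNorm (d : ℕ) (u : Pt d → ℝ) (z : Pt d) : ℝ :=
  Real.sqrt (∑ i : Fin d, spDeriv d i u z ^ 2)

/-- The spatial Laplacian `Δu`. -/
def lap (d : ℕ) (u : Pt d → ℝ) (z : Pt d) : ℝ :=
  ∑ i : Fin d, spDeriv d i (spDeriv d i u) z

/-- The (Frobenius) norm of the spatial Hessian `|D²u|`. -/
def hessNorm (d : ℕ) (u : Pt d → ℝ) (z : Pt d) : ℝ :=
  Real.sqrt (∑ i : Fin d, ∑ j : Fin d, spDeriv d i (spDeriv d j u) z ^ 2)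


section Abstract
set_option linter.unusedSectionVars false

variable {X ι : Type*} [MeasurableSpace X] [Countable ι] [MeasurableSpace ι]
  [MeasurableSingletonClass ι]

/-- average over the cell of level `j` containing `x` -/
def dyAv (μ : Measure X) (c : ℕ → X → ι) (j : ℕ) (f : X → ℝ≥0∞) (x : X) : ℝ≥0∞ :=
  (μ (c j ⁻¹' {c j x}))⁻¹ * ∫⁻ y in c j ⁻¹' {c j x}, f y ∂μ

/-- dyadic maximal function -/
def dyMax (μ : Measure X) (c : ℕ → X → ι) (f : X → ℝ≥0∞) (x : X) : ℝ≥0∞ :=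
  ⨆ j, dyAv μ c j f x

/-- stopping set -/
def dyStop (μ : Measure X) (c : ℕ → X → ι) (f : X → ℝ≥0∞) (l : ℝ≥0∞) (j : ℕ) : Set X :=
  {x | l < dyAv μ c j f x ∧ ∀ i < j, dyAv μ c i f x ≤ l}

lemma dyAv_congr (μ : Measure X) (c : ℕ → X → ι) (j : ℕ) (f : X → ℝ≥0∞) {x y : X}
    (h : c j x = c j y) : dyAv μ c j f x = dyAv μ c j f y := by
  unfold dyAv; rw [h]

lemma dyAv_measurable (μ : Measure X) (c : ℕ → X → ι) (hc : ∀ j, Measurable (c j)) (j : ℕ)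
    (f : X → ℝ≥0∞) : Measurable (dyAv μ c j f) := by
  have : dyAv μ c j f = (fun i : ι => (μ (c j ⁻¹' {i}))⁻¹ * ∫⁻ y in c j ⁻¹' {i}, f y ∂μ) ∘ c j := rfl
  rw [this]
  exact (measurable_of_countable _).comp (hc j)

lemma dyMax_measurable (μ : Measure X) (c : ℕ → X → ι) (hc : ∀ j, Measurable (c j))
    (f : X → ℝ≥0∞) : Measurable (dyMax μ c f) :=
  Measurable.iSup fun j => dyAv_measurable μ c hc j f

lemma dyStop_measurable (μ : Measure X) (c : ℕ → X → ι) (hc : ∀ j, Measurable (c j))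
    (f : X → ℝ≥0∞) (l : ℝ≥0∞) (j : ℕ) : MeasurableSet (dyStop μ c f l j) := by
  have : dyStop μ c f l j = {x | l < dyAv μ c j f x} ∩
      ⋂ i, ⋂ (_ : i < j), {x | dyAv μ c i f x ≤ l} := by
    ext x; simp [dyStop]
  rw [this]
  refine (measurableSet_lt measurable_const (dyAv_measurable μ c hc j f)).inter ?_
  exact MeasurableSet.iInter fun i => MeasurableSet.iInter fun _ =>
    measurableSet_le (dyAv_measurable μ c hc i f) measurable_const

lemma nested_le {X ι : Type*} (c : ℕ → X → ι)
    (hn : ∀ j x y, c (j+1) x = c (j+1) y → c j x = c j y)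
    {i j : ℕ} (hij : i ≤ j) {x y : X} (h : c j x = c j y) : c i x = c i y := by
  induction j, hij using Nat.le_induction with
  | base => exact h
  | succ k _ ih => exact ih (hn k x y h)

lemma dyStop_sat (μ : Measure X) (c : ℕ → X → ι)
    (hn : ∀ j x y, c (j+1) x = c (j+1) y → c j x = c j y)
    (f : X → ℝ≥0∞) (l : ℝ≥0∞) (j : ℕ) {x y : X} (h : c j x = c j y)
    (hx : x ∈ dyStop μ c f l j) : y ∈ dyStop μ c f l j := by
  refine ⟨?_, fun i hi => ?_⟩
  · rw [← dyAv_congr μ c j f h]; exact hx.1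
  · rw [← dyAv_congr μ c i f (nested_le c hn hi.le h)]; exact hx.2 i hi

lemma dyStop_union (μ : Measure X) (c : ℕ → X → ι) (f : X → ℝ≥0∞) (l : ℝ≥0∞) :
    ⋃ j, dyStop μ c f l j = {x | l < dyMax μ c f x} := by
  classical
  ext x
  simp only [mem_iUnion, mem_ofPred_eq, dyMax, lt_iSup_iff]
  constructor
  · rintro ⟨j, hj⟩; exact ⟨j, hj.1⟩
  · intro h
    exact ⟨Nat.find h, Nat.find_spec h, fun i hi => not_lt.1 (Nat.find_min h hi)⟩

lemma dyStop_disj (μ : Measure X) (c : ℕ → X → ι) (f : X → ℝ≥0∞) (l : ℝ≥0∞) :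
    Pairwise (Function.onFun Disjoint (dyStop μ c f l)) := by
  intro i j hij
  refine Set.disjoint_left.2 fun x hi hj => ?_
  rcases lt_or_gt_of_ne hij with h | h
  · exact absurd hi.1 (not_lt.2 (hj.2 i h))
  · exact absurd hj.1 (not_lt.2 (hi.2 j h))

lemma dyStop_tsum (μ : Measure X) (c : ℕ → X → ι) (hc : ∀ j, Measurable (c j))
    (f : X → ℝ≥0∞) (l : ℝ≥0∞) (φ : X → ℝ≥0∞) :
    ∑' j, ∫⁻ x in dyStop μ c f l j, φ x ∂μ = ∫⁻ x in {x | l < dyMax μ c f x}, φ x ∂μ := by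
  rw [← dyStop_union, lintegral_iUnion (dyStop_measurable μ c hc f l) (dyStop_disj μ c f l)]

lemma local_cmp (μ : Measure X) (c : X → ι) (hc : Measurable c) (D : Set X)
    (hD : ∀ x y, c x = c y → x ∈ D → y ∈ D) (φ ψ : X → ℝ≥0∞)
    (h : ∀ x ∈ D, ∫⁻ y in c ⁻¹' {c x}, φ y ∂μ ≤ ∫⁻ y in c ⁻¹' {c x}, ψ y ∂μ) :
    ∫⁻ x in D, φ x ∂μ ≤ ∫⁻ x in D, ψ x ∂μ := by
  have e : D = ⋃ i ∈ c '' D, c ⁻¹' {i} := by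
    ext x
    simp only [mem_iUnion, mem_preimage, mem_singleton_iff, exists_prop]
    constructor
    · intro hx; exact ⟨c x, ⟨x, hx, rfl⟩, rfl⟩
    · rintro ⟨i, ⟨y, hy, rfl⟩, h⟩; exact hD y x h.symm hy
  have key : ∀ χ : X → ℝ≥0∞, ∫⁻ x in D, χ x ∂μ
      = ∑' i : (c '' D), ∫⁻ x in c ⁻¹' {(i : ι)}, χ x ∂μ := by
    intro χ
    conv_lhs => rw [e]
    refine lintegral_biUnion (Set.to_countable _) (fun i _ => hc (measurableSet_singleton i)) ?_ _
    intro i _ j _ hij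
    refine Set.disjoint_left.2 fun x hi hj => hij ?_
    simp only [mem_preimage, mem_singleton_iff] at hi hj
    rw [← hi, ← hj]
  rw [key φ, key ψ]
  refine ENNReal.tsum_le_tsum ?_
  rintro ⟨i, x, hx, rfl⟩
  exact h x hx

lemma dy_weak (μ : Measure X) (c : ℕ → X → ι) (hc : ∀ j, Measurable (c j))
    (hn : ∀ j x y, c (j+1) x = c (j+1) y → c j x = c j y)
    (hpos : ∀ j x, μ (c j ⁻¹' {c j x}) ≠ 0) (hfin : ∀ j x, μ (c j ⁻¹' {c j x}) ≠ ⊤)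
    (f : X → ℝ≥0∞) (l : ℝ≥0∞) :
    l * μ {x | l < dyMax μ c f x} ≤ ∫⁻ x in {x | l < dyMax μ c f x}, f x ∂μ := by
  rw [← setLIntegral_const, ← dyStop_tsum μ c hc, ← dyStop_tsum μ c hc]
  refine ENNReal.tsum_le_tsum fun j => ?_
  refine local_cmp μ (c j) (hc j) _ (fun x y h hx => dyStop_sat μ c hn f l j h hx) _ _ ?_
  intro x hx
  rw [setLIntegral_const]
  have := hx.1.le
  unfold dyAv at this
  calc l * μ (c j ⁻¹' {c j x}) ≤ ((μ (c j ⁻¹' {c j x}))⁻¹ * ∫⁻ y in c j ⁻¹' {c j x}, f y ∂μ)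
        * μ (c j ⁻¹' {c j x}) := by gcongr
    _ = ((μ (c j ⁻¹' {c j x}))⁻¹ * μ (c j ⁻¹' {c j x})) * ∫⁻ y in c j ⁻¹' {c j x}, f y ∂μ := by ring
    _ = _ := by rw [ENNReal.inv_mul_cancel (hpos j x) (hfin j x), one_mul]

/-- dyadic level sum -/
def lev (r : ℝ) (y : ℝ≥0∞) : ℝ≥0∞ :=
  ∑' k : ℤ, if (2:ℝ≥0∞) ^ k < y then ((2:ℝ≥0∞) ^ k) ^ r else 0

lemma le_lev (r : ℝ) (hr : 0 < r) (y : ℝ≥0∞) : y ^ r ≤ 2 ^ r * lev r y := by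
  rcases eq_or_ne y 0 with rfl | h0
  · simp [hr]
  rcases eq_or_ne y ⊤ with rfl | ht
  · have : lev r ⊤ = ⊤ := by
      refine ENNReal.eq_top_of_forall_nnreal_le fun a => ?_
      obtain ⟨n, hn⟩ := pow_unbounded_of_one_lt ((a:ℝ) ^ (1/r)) (one_lt_two)
      have h1 : (a:ℝ≥0∞) ≤ ((2:ℝ≥0∞) ^ (n:ℤ)) ^ r := by
        have : (a:ℝ≥0∞) = ((a:ℝ≥0∞)^(1/r))^r := by
          rw [← ENNReal.rpow_mul, one_div, inv_mul_cancel₀ hr.ne', ENNReal.rpow_one]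
        rw [this]
        gcongr
        rw [zpow_natCast, ← ENNReal.coe_rpow_of_nonneg _ (by positivity)]
        have h2 : (a ^ (1/r) : NNReal) ≤ (2:NNReal)^n := by
          rw [← NNReal.coe_le_coe]; push_cast; exact hn.le
        exact_mod_cast h2
      refine h1.trans ?_
      refine le_trans ?_ (ENNReal.le_tsum (n:ℤ))
      rw [if_pos]
      simp
    rw [this]
    simp [ENNReal.mul_top, hr]
  · obtain ⟨n, hn⟩ := ENNReal.exists_mem_Ioc_zpow h0 ht (y := 2) (by norm_num) (by norm_num)
    calc y ^ r ≤ ((2:ℝ≥0∞) ^ (n+1)) ^ r := by gcongr; exact hn.2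
      _ = 2 ^ r * ((2:ℝ≥0∞) ^ n) ^ r := by
          rw [ENNReal.zpow_add (by norm_num) (by norm_num), zpow_one, mul_comm,
            ENNReal.mul_rpow_of_nonneg _ _ hr.le]
      _ ≤ _ := by
          gcongr
          refine le_trans ?_ (ENNReal.le_tsum n)
          rw [if_pos hn.1]

lemma lev_le (r : ℝ) (hr : 0 < r) : ∃ C : ℝ≥0∞, C ≠ ⊤ ∧ ∀ y, lev r y ≤ C * y ^ r := by
  have hlt : (2:ℝ≥0∞) ^ (-r) < 1 := ENNReal.rpow_lt_one_of_one_lt_of_neg (by norm_num) (by linarith)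
  refine ⟨(1 - (2:ℝ≥0∞) ^ (-r))⁻¹, ?_, ?_⟩
  · exact ENNReal.inv_ne_top.2 (tsub_pos_of_lt hlt).ne'
  intro y
  rcases eq_or_ne y 0 with rfl | h0
  · simp [lev]
  rcases eq_or_ne y ⊤ with rfl | ht
  · rw [ENNReal.top_rpow_of_pos hr, ENNReal.mul_top]
    · exact le_top
    · exact ENNReal.inv_ne_zero.2 (ne_top_of_le_ne_top one_ne_top tsub_le_self)
  · obtain ⟨n, hn⟩ := ENNReal.exists_mem_Ioc_zpow h0 ht (y := 2) (by norm_num) (by norm_num)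
    have e : lev r y = ∑' j : ℕ, ((2:ℝ≥0∞) ^ (n - j)) ^ r := by
      unfold lev
      have hinj : Function.Injective (fun j : ℕ => n - (j:ℤ)) := by
        intro a b h; simpa using h
      rw [← hinj.tsum_eq]
      · refine tsum_congr fun j => ?_
        rw [if_pos]
        refine lt_of_le_of_lt ?_ hn.1
        exact ENNReal.zpow_le_of_le (by norm_num) (by omega)
      · intro k hk
        simp only [Function.mem_support, ne_eq, ite_eq_right_iff, not_forall] at hk
        obtain ⟨h, -⟩ := hk
        have : k < n + 1 := by
          by_contra hcon
          have h3 := ENNReal.zpow_le_of_le (x := 2) (by norm_num) (not_lt.1 hcon)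
          exact absurd (h.trans_le hn.2) (not_lt.2 h3)
        refine ⟨(n - k).toNat, ?_⟩
        simp only
        omega
    rw [e]
    have e2 : ∀ j : ℕ, ((2:ℝ≥0∞) ^ (n - j)) ^ r = ((2:ℝ≥0∞) ^ n) ^ r * ((2:ℝ≥0∞) ^ (-r)) ^ j := by
      intro j
      rw [sub_eq_add_neg, ENNReal.zpow_add (by norm_num) (by norm_num),
            ENNReal.mul_rpow_of_nonneg _ _ hr.le]
      congr 1
      rw [← ENNReal.rpow_intCast, ← ENNReal.rpow_natCast, ← ENNReal.rpow_mul, ← ENNReal.rpow_mul]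
      congr 1
      push_cast; ring
    simp_rw [e2]
    rw [ENNReal.tsum_mul_left, ENNReal.tsum_geometric, mul_comm]
    gcongr
    exact hn.1.le

lemma lev_integral (μ : Measure X) (r : ℝ) (F h : X → ℝ≥0∞) (hF : Measurable F)
    (hh : Measurable h) :
    ∫⁻ x, lev r (F x) * h x ∂μ
      = ∑' k : ℤ, ((2:ℝ≥0∞) ^ k) ^ r * ∫⁻ x in {x | (2:ℝ≥0∞) ^ k < F x}, h x ∂μ := by
  have hm : ∀ k : ℤ, MeasurableSet {x | (2:ℝ≥0∞) ^ k < F x} :=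
    fun k => measurableSet_lt measurable_const hF
  have : ∀ x, lev r (F x) * h x = ∑' k : ℤ, ((2:ℝ≥0∞) ^ k) ^ r *
      ({x | (2:ℝ≥0∞) ^ k < F x}.indicator h x) := by
    intro x
    unfold lev
    rw [← ENNReal.tsum_mul_right]
    refine tsum_congr fun k => ?_
    by_cases hk : (2:ℝ≥0∞) ^ k < F x
    · simp [hk]
    · simp [hk]
  simp_rw [this]
  rw [lintegral_tsum]
  · refine tsum_congr fun k => ?_
    rw [lintegral_const_mul _ (hh.indicator (hm k)), lintegral_indicator (hm k)]
  · intro k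
    exact (measurable_const.mul (hh.indicator (hm k))).aemeasurable

lemma dy_strong (p : ℝ) (hp : 1 < p) : ∃ C : ℝ≥0∞, C ≠ ⊤ ∧
    ∀ (μ : Measure X) (c : ℕ → X → ι) (_ : ∀ j, Measurable (c j))
    (_ : ∀ j x y, c (j+1) x = c (j+1) y → c j x = c j y)
    (_ : ∀ j x, μ (c j ⁻¹' {c j x}) ≠ 0) (_ : ∀ j x, μ (c j ⁻¹' {c j x}) ≠ ⊤)
    (f : X → ℝ≥0∞) (_ : Measurable f),
    ∫⁻ x, dyMax μ c f x ^ p ∂μ ≤ C * ∫⁻ x, f x ^ p ∂μ := by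
  obtain ⟨C, hC, hlev⟩ := lev_le (p - 1) (by linarith)
  refine ⟨2 ^ p * (2 * (C * 2 ^ (p - 1))), ?_, ?_⟩
  · refine ENNReal.mul_ne_top ?_ (ENNReal.mul_ne_top (by norm_num) (ENNReal.mul_ne_top hC ?_))
    · exact ENNReal.rpow_ne_top_of_nonneg (by linarith) (by norm_num)
    · exact ENNReal.rpow_ne_top_of_nonneg (by linarith) (by norm_num)
  intro μ c hc hn hpos hfin f hf
  have hM := dyMax_measurable μ c hc f
  have weak : ∀ k : ℤ, (2:ℝ≥0∞)^k * μ {x | (2:ℝ≥0∞)^k < dyMax μ c f x}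
      ≤ 2 * ∫⁻ x in {x | (2:ℝ≥0∞)^k < 2 * f x}, f x ∂μ := by
    intro k
    set l : ℝ≥0∞ := 2^k / 2 with hl
    have hl2 : (2:ℝ≥0∞)^k = 2 * l := by
      rw [hl, ENNReal.mul_div_cancel (by norm_num) (by norm_num)]
    have hl2' : (2:ℝ≥0∞)^k = l + l := by rw [hl2, two_mul]
    have hltop : l ≠ ⊤ := by
      rw [hl]; exact ENNReal.div_ne_top (ENNReal.zpow_ne_top (by norm_num) (by norm_num) _) (by norm_num)
    have hms : MeasurableSet {x | (2:ℝ≥0∞)^k < 2 * f x} :=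
      measurableSet_lt measurable_const (hf.const_mul 2)
    set f' := {x | (2:ℝ≥0∞)^k < 2 * f x}.indicator f with hf'
    have hff : ∀ x, f x ≤ l + f' x := by
      intro x
      by_cases h : (2:ℝ≥0∞)^k < 2 * f x
      · simp [hf', h]
      · simp only [hf', indicator, mem_ofPred_eq, h, if_false, add_zero]
        rw [hl2, not_lt] at h
        exact (ENNReal.mul_le_mul_iff_right (by norm_num) (by norm_num)).1 h
    have hav : ∀ j x, dyAv μ c j f x ≤ l + dyAv μ c j f' x := by
      intro j x
      unfold dyAv
      calc _ ≤ (μ (c j ⁻¹' {c j x}))⁻¹ * ∫⁻ y in c j ⁻¹' {c j x}, (l + f' y) ∂μ := by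
            gcongr with y; exact hff y
        _ = _ := by
            rw [lintegral_add_left measurable_const, setLIntegral_const, mul_add, mul_left_comm,
              ENNReal.inv_mul_cancel (hpos j x) (hfin j x), mul_one]
    have hmx : ∀ x, dyMax μ c f x ≤ l + dyMax μ c f' x := by
      intro x
      refine iSup_le fun j => (hav j x).trans ?_
      gcongr
      exact le_iSup (fun j => dyAv μ c j f' x) j
    have hsub : {x | (2:ℝ≥0∞)^k < dyMax μ c f x} ⊆ {x | l < dyMax μ c f' x} := by
      intro x hx
      have h1 : l + l < l + dyMax μ c f' x := by
        rw [← hl2']; exact lt_of_lt_of_le hx (hmx x)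
      exact (ENNReal.add_lt_add_iff_left hltop).1 h1
    calc (2:ℝ≥0∞)^k * μ {x | (2:ℝ≥0∞)^k < dyMax μ c f x}
        ≤ 2 * l * μ {x | l < dyMax μ c f' x} := by rw [← hl2]; gcongr
      _ = 2 * (l * μ {x | l < dyMax μ c f' x}) := by ring
      _ ≤ 2 * ∫⁻ x in {x | l < dyMax μ c f' x}, f' x ∂μ := by
          gcongr; exact dy_weak μ c hc hn hpos hfin f' l
      _ ≤ 2 * ∫⁻ x, f' x ∂μ := mul_le_mul_right (setLIntegral_le_lintegral _ _) _
      _ = _ := by rw [hf', lintegral_indicator hms]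
  calc ∫⁻ x, dyMax μ c f x ^ p ∂μ ≤ ∫⁻ x, 2 ^ p * (lev p (dyMax μ c f x) * 1) ∂μ := by
        gcongr with x; rw [mul_one]; exact le_lev p (by linarith) _
    _ = 2 ^ p * ∫⁻ x, lev p (dyMax μ c f x) * 1 ∂μ := by
        rw [lintegral_const_mul']
        exact ENNReal.rpow_ne_top_of_nonneg (by linarith) (by norm_num)
    _ = 2 ^ p * ∑' k : ℤ, ((2:ℝ≥0∞) ^ k) ^ p * μ {x | (2:ℝ≥0∞)^k < dyMax μ c f x} := by
        rw [lev_integral μ p _ (fun _ => 1) hM measurable_const]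
        simp
    _ ≤ 2 ^ p * ∑' k : ℤ, 2 * (((2:ℝ≥0∞) ^ k) ^ (p-1) *
          ∫⁻ x in {x | (2:ℝ≥0∞)^k < 2 * f x}, f x ∂μ) := by
        refine mul_le_mul_right (ENNReal.tsum_le_tsum fun k => ?_) _
        have : ((2:ℝ≥0∞) ^ k) ^ p = ((2:ℝ≥0∞) ^ k) ^ (p-1) * (2:ℝ≥0∞) ^ k := by
          conv_rhs => rw [← ENNReal.rpow_one ((2:ℝ≥0∞)^k), ← ENNReal.rpow_mul, one_mul]
          rw [← ENNReal.rpow_add]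
          · simp
          · exact (ENNReal.zpow_pos (by norm_num) (by norm_num) _).ne'
          · exact ENNReal.zpow_ne_top (by norm_num) (by norm_num) _
        rw [this, mul_assoc, mul_left_comm 2]
        exact mul_le_mul_right (weak k) _
    _ = 2 ^ p * (2 * ∫⁻ x, lev (p-1) (2 * f x) * f x ∂μ) := by
        rw [ENNReal.tsum_mul_left, lev_integral μ (p-1) _ f (hf.const_mul 2) hf]
    _ ≤ 2 ^ p * (2 * ∫⁻ x, (C * 2 ^ (p - 1)) * f x ^ p ∂μ) := by
        refine mul_le_mul_right (mul_le_mul_right (lintegral_mono fun x => ?_) _) _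
        calc lev (p-1) (2 * f x) * f x ≤ C * (2 * f x) ^ (p-1) * f x := by gcongr; exact hlev _
          _ = (C * 2 ^ (p - 1)) * (f x ^ (p - 1) * f x ^ (1:ℝ)) := by
              rw [ENNReal.mul_rpow_of_nonneg _ _ (by linarith), ENNReal.rpow_one]; ring
          _ = _ := by
              rw [← ENNReal.rpow_add_of_nonneg _ _ (by linarith) (by norm_num)]; simp
    _ = _ := by
        rw [lintegral_const_mul _ (hf.pow_const p)]; ring

lemma dy_bilin (μ : Measure X) (c : ℕ → X → ι) (hc : ∀ j, Measurable (c j))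
    (hn : ∀ j x y, c (j+1) x = c (j+1) y → c j x = c j y)
    (ℓ : ℕ → ℝ≥0∞) (hℓ : ∀ j0, ∑' j, ℓ (j0 + j) ≤ 2 * ℓ j0)
    (C : ℝ≥0∞) (hC : ∀ y, lev 1 y ≤ C * y ^ (1:ℝ))
    (f h G : X → ℝ≥0∞) (hh : Measurable h) (hG : Measurable G)
    (H : ∀ j x, ℓ j * ∫⁻ y in c j ⁻¹' {c j x}, h y ∂μ ≤ ∫⁻ y in c j ⁻¹' {c j x}, G y ∂μ) :
    ∫⁻ x, (∑' j, ℓ j * dyAv μ c j f x) * h x ∂μ ≤ 4 * C * ∫⁻ x, dyMax μ c f x * G x ∂μ := by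
  have hA := fun j => dyAv_measurable μ c hc j f
  have hms : ∀ (k : ℤ) j, MeasurableSet {x | (2:ℝ≥0∞)^k < dyAv μ c j f x} :=
    fun k j => measurableSet_lt measurable_const (hA j)
  have level : ∀ l : ℝ≥0∞, ∑' j, ℓ j * ∫⁻ x in {x | l < dyAv μ c j f x}, h x ∂μ
      ≤ 2 * ∫⁻ x in {x | l < dyMax μ c f x}, G x ∂μ := by
    intro l
    have hms : ∀ j, MeasurableSet {x | l < dyAv μ c j f x} :=
      fun j => measurableSet_lt measurable_const (hA j)
    have hmD := dyStop_measurable μ c hc f l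
    have pt : ∀ x, ∑' j, ℓ j * {x | l < dyAv μ c j f x}.indicator h x
        ≤ ∑' j, 2 * (ℓ j * (dyStop μ c f l j).indicator h x) := by
      intro x
      by_cases hx : x ∈ ⋃ j, dyStop μ c f l j
      · obtain ⟨j0, hj0⟩ := mem_iUnion.1 hx
        refine le_trans ?_ (ENNReal.le_tsum j0)
        rw [indicator_of_mem hj0]
        have hz : ∀ j, j < j0 → ℓ j * {x | l < dyAv μ c j f x}.indicator h x = 0 := by
          intro j hj
          rw [indicator_of_notMem, mul_zero]
          exact not_lt.2 (hj0.2 j hj)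
        rw [← ENNReal.summable.sum_add_tsum_nat_add' (k := j0),
          Finset.sum_eq_zero (fun j hj => hz j (Finset.mem_range.1 hj)), zero_add]
        calc ∑' j, ℓ (j + j0) * {x | l < dyAv μ c (j + j0) f x}.indicator h x
            ≤ ∑' j, ℓ (j0 + j) * h x := by
              refine ENNReal.tsum_le_tsum fun j => ?_
              rw [add_comm j j0]
              gcongr
              exact indicator_le_self _ _ _
          _ ≤ 2 * ℓ j0 * h x := by rw [ENNReal.tsum_mul_right]; gcongr; exact hℓ j0
          _ = _ := by ring
      · have : ∀ j, ℓ j * {x | l < dyAv μ c j f x}.indicator h x = 0 := by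
          intro j
          rw [indicator_of_notMem, mul_zero]
          intro hj
          rw [dyStop_union] at hx
          exact hx (lt_of_lt_of_le hj (le_iSup (fun j => dyAv μ c j f x) j))
        simp [this]
    calc ∑' j, ℓ j * ∫⁻ x in {x | l < dyAv μ c j f x}, h x ∂μ
        = ∫⁻ x, ∑' j, ℓ j * {x | l < dyAv μ c j f x}.indicator h x ∂μ := by
          rw [lintegral_tsum fun j => ((hh.indicator (hms j)).const_mul (ℓ j)).aemeasurable]
          refine tsum_congr fun j => ?_
          rw [lintegral_const_mul _ (hh.indicator (hms j)), lintegral_indicator (hms j)]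
      _ ≤ ∫⁻ x, ∑' j, 2 * (ℓ j * (dyStop μ c f l j).indicator h x) ∂μ := lintegral_mono pt
      _ = ∑' j, 2 * (ℓ j * ∫⁻ x in dyStop μ c f l j, h x ∂μ) := by
          rw [lintegral_tsum fun j =>
            (((hh.indicator (hmD j)).const_mul (ℓ j)).const_mul 2).aemeasurable]
          refine tsum_congr fun j => ?_
          rw [lintegral_const_mul _ ((hh.indicator (hmD j)).const_mul (ℓ j)),
            lintegral_const_mul _ (hh.indicator (hmD j)), lintegral_indicator (hmD j)]
      _ ≤ ∑' j, 2 * ∫⁻ x in dyStop μ c f l j, G x ∂μ := by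
          gcongr with j
          rw [← lintegral_const_mul _ hh]
          refine local_cmp μ (c j) (hc j) _ (fun x y h hx => dyStop_sat μ c hn f l j h hx) _ _ ?_
          intro x _
          rw [lintegral_const_mul _ hh]
          exact H j x
      _ = _ := by rw [ENNReal.tsum_mul_left, dyStop_tsum μ c hc]
  calc ∫⁻ x, (∑' j, ℓ j * dyAv μ c j f x) * h x ∂μ
      = ∑' j, ℓ j * ∫⁻ x, dyAv μ c j f x * h x ∂μ := by
        simp_rw [← ENNReal.tsum_mul_right]
        have hm1 : ∀ j, Measurable fun x => dyAv μ c j f x * h x := fun j => (hA j).mul hh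
        have hm2 : ∀ j, AEMeasurable (fun x => ℓ j * dyAv μ c j f x * h x) μ := fun j =>
          (((hA j).const_mul (ℓ j)).mul hh).aemeasurable
        rw [lintegral_tsum hm2]
        refine tsum_congr fun j => ?_
        rw [← lintegral_const_mul _ (hm1 j)]
        simp_rw [mul_assoc]
    _ ≤ ∑' j, ℓ j * ∫⁻ x, 2 * (lev 1 (dyAv μ c j f x) * h x) ∂μ := by
        refine ENNReal.tsum_le_tsum fun j => mul_le_mul_right (lintegral_mono fun x => ?_) _
        rw [← mul_assoc]
        gcongr
        simpa using le_lev 1 one_pos (dyAv μ c j f x)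
    _ = ∑' j, ∑' k : ℤ, 2 * ((2:ℝ≥0∞) ^ k * (ℓ j *
          ∫⁻ x in {x | (2:ℝ≥0∞)^k < dyAv μ c j f x}, h x ∂μ)) := by
        refine tsum_congr fun j => ?_
        rw [lintegral_const_mul' _ _ (by norm_num), lev_integral μ 1 _ h (hA j) hh,
          ← ENNReal.tsum_mul_left, ← ENNReal.tsum_mul_left]
        refine tsum_congr fun k => ?_
        rw [ENNReal.rpow_one]; ring
    _ = ∑' k : ℤ, 2 * ((2:ℝ≥0∞) ^ k * ∑' j, (ℓ j *
          ∫⁻ x in {x | (2:ℝ≥0∞)^k < dyAv μ c j f x}, h x ∂μ)) := by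
        rw [ENNReal.tsum_comm]
        simp_rw [ENNReal.tsum_mul_left]
    _ ≤ ∑' k : ℤ, 2 * ((2:ℝ≥0∞) ^ k * (2 * ∫⁻ x in {x | (2:ℝ≥0∞)^k < dyMax μ c f x}, G x ∂μ)) := by
        gcongr with k; exact level _
    _ = 4 * ∑' k : ℤ, ((2:ℝ≥0∞) ^ k) ^ (1:ℝ) * ∫⁻ x in {x | (2:ℝ≥0∞)^k < dyMax μ c f x}, G x ∂μ := by
        rw [← ENNReal.tsum_mul_left]
        refine tsum_congr fun k => ?_
        rw [ENNReal.rpow_one]; ring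
    _ = 4 * ∫⁻ x, lev 1 (dyMax μ c f x) * G x ∂μ := by
        rw [lev_integral μ 1 _ G (dyMax_measurable μ c hc f) hG]
    _ ≤ 4 * ∫⁻ x, C * (dyMax μ c f x * G x) ∂μ := by
        refine mul_le_mul_right (lintegral_mono fun x => ?_) _
        rw [← mul_assoc]
        gcongr
        simpa using hC (dyMax μ c f x)
    _ = _ := by
        have hm3 : Measurable fun x => dyMax μ c f x * G x := (dyMax_measurable μ c hc f).mul hG
        rw [lintegral_const_mul _ hm3]; ring

lemma dual_bound (μ : Measure X) [SigmaFinite μ] (p : ℝ) (hp : 1 < p) (u : X → ℝ≥0∞)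
    (hu : Measurable u) (K : ℝ≥0∞)
    (H : ∀ g : X → ℝ≥0∞, Measurable g →
      ∫⁻ x, u x * g x ∂μ ≤ K * (∫⁻ x, g x ^ (p / (p-1)) ∂μ) ^ (1 / (p / (p-1)))) :
    ∫⁻ x, u x ^ p ∂μ ≤ K ^ p := by
  have hp0 : 0 < p := by linarith
  have hp1 : 0 < p - 1 := by linarith
  set v : ℕ → X → ℝ≥0∞ := fun m => (spanningSets μ m).indicator (fun x => min (u x) m) with hv
  have hvm : ∀ m, Measurable (v m) := fun m =>
    (hu.min measurable_const).indicator (measurableSet_spanningSets μ m)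
  have hvmono : Monotone v := by
    intro m n hmn x
    simp only [hv]
    refine (indicator_le_indicator_of_subset (monotone_spanningSets μ hmn) (fun _ => zero_le) x).trans ?_
    refine indicator_le_indicator ?_
    gcongr
  have hvle : ∀ m x, v m x ≤ u x := by
    intro m x
    refine (indicator_le_self _ _ _).trans (min_le_left _ _)
  have hvsup : ∀ x, ⨆ m, v m x = u x := by
    intro x
    refine le_antisymm (iSup_le fun m => hvle m x) ?_
    refine le_of_forall_lt fun a ha => ?_
    obtain ⟨n, hn⟩ := ENNReal.exists_nat_gt (ne_top_of_lt ha)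
    have hx : x ∈ spanningSets μ (max n (spanningSetsIndex μ x)) :=
      monotone_spanningSets μ (le_max_right _ _) (mem_spanningSetsIndex μ x)
    refine lt_of_lt_of_le ?_ (le_iSup _ (max n (spanningSetsIndex μ x)))
    simp only [hv]
    rw [indicator_of_mem hx]
    refine lt_min ha (hn.trans_le ?_)
    exact_mod_cast le_max_left _ _
  have hfin : ∀ m, ∫⁻ x, v m x ^ p ∂μ ≠ ⊤ := by
    intro m
    refine ne_top_of_le_ne_top (b := (m:ℝ≥0∞) ^ p * μ (spanningSets μ m)) ?_ ?_
    · exact ENNReal.mul_ne_top (ENNReal.rpow_ne_top_of_nonneg hp0.le (by simp))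
        (measure_spanningSets_lt_top μ m).ne
    · rw [← lintegral_indicator_const (measurableSet_spanningSets μ m)]
      refine lintegral_mono fun x => ?_
      by_cases hx : x ∈ spanningSets μ m
      · simp only [hv, indicator_of_mem hx]
        gcongr
        exact min_le_right _ _
      · simp [hv, indicator_of_notMem hx, hp0]
  have main : ∀ m, ∫⁻ x, v m x ^ p ∂μ ≤ K ^ p := by
    intro m
    set I := ∫⁻ x, v m x ^ p ∂μ with hI
    have h1 : I ≤ K * I ^ (1 / (p / (p-1))) := by
      calc I ≤ ∫⁻ x, u x * (v m x) ^ (p-1) ∂μ := by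
            refine lintegral_mono fun x => ?_
            calc v m x ^ p = v m x ^ (1 + (p-1)) := by congr 1; ring
              _ = v m x * v m x ^ (p-1) := by
                rw [ENNReal.rpow_add_of_nonneg _ _ (by norm_num) hp1.le, ENNReal.rpow_one]
              _ ≤ _ := by gcongr; exact hvle m x
        _ ≤ _ := by
            refine (H _ ((hvm m).pow_const _)).trans (le_of_eq ?_)
            simp_rw [← ENNReal.rpow_mul]
            rw [mul_div_cancel₀ _ hp1.ne']
    rcases eq_or_ne I 0 with h0 | h0
    · rw [h0]; exact zero_le
    have e : I = I ^ (1/p) * I ^ (1 / (p / (p-1))) := by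
      rw [← ENNReal.rpow_add _ _ h0 (hfin m)]
      have : 1 / p + 1 / (p / (p-1)) = 1 := by field_simp; ring
      rw [this, ENNReal.rpow_one]
    have h2 : I ^ (1/p) ≤ K := by
      rw [e] at h1
      conv_lhs at h1 => rw [← e]
      have h3 : I ^ (1/p) * I ^ (1 / (p / (p-1))) ≤ K * I ^ (1 / (p / (p-1))) := by
        rw [← e]
        rwa [← e] at h1
      refine (ENNReal.mul_le_mul_iff_left ?_ ?_).1 h3
      · exact (ENNReal.rpow_pos (pos_iff_ne_zero.2 h0) (hfin m)).ne'
      · exact ENNReal.rpow_ne_top_of_nonneg (by positivity) (hfin m)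
    calc I = (I ^ (1/p)) ^ p := by
          rw [← ENNReal.rpow_mul, one_div, inv_mul_cancel₀ hp0.ne', ENNReal.rpow_one]
      _ ≤ _ := by gcongr
  calc ∫⁻ x, u x ^ p ∂μ = ∫⁻ x, ⨆ m, v m x ^ p ∂μ := by
        refine lintegral_congr fun x => ?_
        rw [← hvsup x]
        exact (ENNReal.orderIsoRpow p hp0).map_iSup _
    _ = ⨆ m, ∫⁻ x, v m x ^ p ∂μ := by
        refine lintegral_iSup (fun m => (hvm m).pow_const p) ?_
        intro m n hmn x
        simp only
        gcongr
        exact hvmono hmn x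
    _ ≤ _ := iSup_le main

end Abstract
lemma dy_trace {X ι : Type*} [MeasurableSpace X] [Countable ι] [MeasurableSpace ι]
    [MeasurableSingletonClass ι] (p q : ℝ) (hp : 1 < p) (hpq : p < q) : ∃ C : ℝ≥0∞, C ≠ ⊤ ∧
    ∀ (μ : Measure X) (_ : SigmaFinite μ) (c : ℕ → X → ι) (_ : ∀ j, Measurable (c j))
    (_ : ∀ j x y, c (j+1) x = c (j+1) y → c j x = c j y)
    (_ : ∀ j x, μ (c j ⁻¹' {c j x}) ≠ 0) (_ : ∀ j x, μ (c j ⁻¹' {c j x}) ≠ ⊤)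
    (ℓ : ℕ → ℝ≥0∞) (_ : ∀ j0, ∑' j, ℓ (j0 + j) ≤ 2 * ℓ j0)
    (b f : X → ℝ≥0∞) (_ : Measurable b) (_ : Measurable f) (B : ℝ≥0∞)
    (_ : ∀ j x, ℓ j * (∫⁻ y in c j ⁻¹' {c j x}, b y ^ q ∂μ) ^ (1 / q)
      ≤ B * μ (c j ⁻¹' {c j x}) ^ (1 / q)),
    ∫⁻ x, (b x * ∑' j, ℓ j * dyAv μ c j f x) ^ p ∂μ ≤ C * B ^ p * ∫⁻ x, f x ^ p ∂μ := by
  have hp0 : 0 < p := by linarith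
  have hp1 : 0 < p - 1 := by linarith
  have hq0 : 0 < q := by linarith
  have hq1 : 0 < q - 1 := by linarith
  set p' := p / (p - 1) with hp'
  set q' := q / (q - 1) with hq'
  have hpp : p.HolderConjugate p' := Real.HolderConjugate.conjExponent hp
  have hqq : q.HolderConjugate q' := Real.HolderConjugate.conjExponent (by linarith)
  have hp'0 : 0 < p' := by positivity
  have hq'0 : 0 < q' := by positivity
  have hr : 1 < p' / q' := by
    rw [one_lt_div hq'0, hp', hq', div_lt_div_iff₀ hq1 hp1]
    nlinarith
  obtain ⟨C1, hC1, hlev⟩ := lev_le 1 one_pos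
  obtain ⟨C2, hC2, hM2⟩ := dy_strong (X := X) (ι := ι) p hp
  obtain ⟨C3, hC3, hM3⟩ := dy_strong (X := X) (ι := ι) (p' / q') hr
  refine ⟨(4 * C1 * C2 ^ (1/p) * C3 ^ (1/p')) ^ p, ?_, ?_⟩
  · refine ENNReal.rpow_ne_top_of_nonneg hp0.le ?_
    refine ENNReal.mul_ne_top (ENNReal.mul_ne_top (ENNReal.mul_ne_top (by norm_num) hC1) ?_) ?_
    · exact ENNReal.rpow_ne_top_of_nonneg (by positivity) hC2
    · exact ENNReal.rpow_ne_top_of_nonneg (by positivity) hC3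
  intro μ _ c hc hn hpos hfin ℓ hℓ b f hb hf B hB
  have hT : Measurable fun x => ∑' j, ℓ j * dyAv μ c j f x :=
    Measurable.tsum fun j => (dyAv_measurable μ c hc j f).const_mul _
  have key := dual_bound μ p hp (fun x => b x * ∑' j, ℓ j * dyAv μ c j f x) (hb.mul hT)
    ((4 * C1 * C2 ^ (1/p) * C3 ^ (1/p')) * B * (∫⁻ x, f x ^ p ∂μ) ^ (1/p)) ?_
  · refine key.trans (le_of_eq ?_)
    rw [ENNReal.mul_rpow_of_nonneg _ _ hp0.le, ENNReal.mul_rpow_of_nonneg _ _ hp0.le,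
      ← ENNReal.rpow_mul (∫⁻ x, f x ^ p ∂μ), one_div_mul_cancel hp0.ne', ENNReal.rpow_one]
  intro g hg
  set mg : X → ℝ≥0∞ := dyMax μ c (fun x => g x ^ q') with hmg
  have hmgm : Measurable mg := dyMax_measurable μ c hc _
  have hbg : Measurable fun x => b x * g x := hb.mul hg
  have hGm : Measurable fun x => B * mg x ^ (1/q') := (hmgm.pow_const _).const_mul _
  have hb1 := dy_bilin μ c hc hn ℓ hℓ C1 hlev f (fun x => b x * g x)
    (fun x => B * mg x ^ (1/q')) hbg hGm ?_
  · calc ∫⁻ x, b x * (∑' j, ℓ j * dyAv μ c j f x) * g x ∂μ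
        = ∫⁻ x, (∑' j, ℓ j * dyAv μ c j f x) * (b x * g x) ∂μ := by
          refine lintegral_congr fun x => ?_
          ring
      _ ≤ _ := hb1
      _ = 4 * C1 * (B * ∫⁻ x, (dyMax μ c f * fun x => mg x ^ (1/q')) x ∂μ) := by
          have hm4 : Measurable (dyMax μ c f * fun x => mg x ^ (1/q')) :=
            (dyMax_measurable μ c hc f).mul (hmgm.pow_const _)
          rw [← lintegral_const_mul B hm4]
          congr 1
          refine lintegral_congr fun x => ?_
          simp only [Pi.mul_apply]
          ring
      _ ≤ 4 * C1 * (B * ((∫⁻ x, dyMax μ c f x ^ p ∂μ) ^ (1/p) *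
            (∫⁻ x, (mg x ^ (1/q')) ^ p' ∂μ) ^ (1/p'))) := by
          refine mul_le_mul_right (mul_le_mul_right ?_ _) _
          exact ENNReal.lintegral_mul_le_Lp_mul_Lq μ hpp (dyMax_measurable μ c hc f).aemeasurable
            (hmgm.pow_const _).aemeasurable
      _ ≤ 4 * C1 * (B * ((C2 * ∫⁻ x, f x ^ p ∂μ) ^ (1/p) *
            (C3 * ∫⁻ x, g x ^ p' ∂μ) ^ (1/p'))) := by
          refine mul_le_mul_right (mul_le_mul_right (mul_le_mul' ?_ ?_) _) _
          · exact ENNReal.rpow_le_rpow (hM2 μ c hc hn hpos hfin f hf) (by positivity)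
          · refine ENNReal.rpow_le_rpow ?_ (by positivity)
            have h5 := hM3 μ c hc hn hpos hfin (fun x => g x ^ q') (hg.pow_const _)
            simp_rw [← ENNReal.rpow_mul, mul_div_cancel₀ _ hq'0.ne'] at h5
            simp_rw [← ENNReal.rpow_mul, one_div_mul_eq_div]
            exact h5
      _ = _ := by
          rw [ENNReal.mul_rpow_of_nonneg _ _ (by positivity : 0 ≤ 1/p),
            ENNReal.mul_rpow_of_nonneg _ _ (by positivity : 0 ≤ 1/p')]
          ring
  intro j x
  set Q := c j ⁻¹' {c j x} with hQ
  have hQm : MeasurableSet Q := hc j (measurableSet_singleton _)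
  have h6 : ∫⁻ y in Q, b y * g y ∂μ ≤ (∫⁻ y in Q, b y ^ q ∂μ) ^ (1/q) *
      (∫⁻ y in Q, g y ^ q' ∂μ) ^ (1/q') :=
    ENNReal.lintegral_mul_le_Lp_mul_Lq _ hqq hb.aemeasurable hg.aemeasurable
  have hQ0 : μ Q ≠ 0 := hpos j x
  have hQt : μ Q ≠ ⊤ := hfin j x
  calc ℓ j * ∫⁻ y in Q, b y * g y ∂μ ≤ ℓ j * ((∫⁻ y in Q, b y ^ q ∂μ) ^ (1/q) *
      (∫⁻ y in Q, g y ^ q' ∂μ) ^ (1/q')) := mul_le_mul_right h6 _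
    _ = (ℓ j * (∫⁻ y in Q, b y ^ q ∂μ) ^ (1/q)) * (∫⁻ y in Q, g y ^ q' ∂μ) ^ (1/q') := by ring
    _ ≤ (B * μ Q ^ (1/q)) * (∫⁻ y in Q, g y ^ q' ∂μ) ^ (1/q') := mul_le_mul_left (hB j x) _
    _ = B * ((μ Q)⁻¹ * ∫⁻ y in Q, g y ^ q' ∂μ) ^ (1/q') * μ Q := by
        rw [ENNReal.mul_rpow_of_nonneg _ _ (by positivity : 0 ≤ 1/q'), ENNReal.inv_rpow,
          ← ENNReal.rpow_neg]
        have : μ Q ^ (1/q) = μ Q ^ (-(1/q')) * μ Q := by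
          conv_rhs => rw [← ENNReal.rpow_one (μ Q), ← ENNReal.rpow_mul, one_mul]
          rw [← ENNReal.rpow_add _ _ hQ0 hQt]
          congr 1
          have := hqq.inv_add_inv_eq_one
          rw [one_div, one_div]; linarith
        rw [this]; ring
    _ = ∫⁻ y in Q, B * ((μ Q)⁻¹ * ∫⁻ y in Q, g y ^ q' ∂μ) ^ (1/q') ∂μ := by
        rw [setLIntegral_const]
    _ ≤ ∫⁻ y in Q, B * mg y ^ (1/q') ∂μ := by
        refine setLIntegral_mono hGm fun y hy => ?_
        have hy' : c j y = c j x := hy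
        refine mul_le_mul_right (ENNReal.rpow_le_rpow ?_ (by positivity)) _
        have : (μ Q)⁻¹ * ∫⁻ y in Q, g y ^ q' ∂μ = dyAv μ c j (fun x => g x ^ q') y := by
          unfold dyAv; rw [hy']
        rw [this]
        exact le_iSup (fun j => dyAv μ c j (fun x => g x ^ q') y) j

/-- shifted parabolic dyadic grid -/
def gCell (d : ℕ) (θ : Bool × (Fin d → Bool)) (n : ℤ) (z : Pt d) : ℤ × (Fin d → ℤ) :=
  (⌊z.1 / 4 ^ n + (if θ.1 then 1 / 3 else 0)⌋,
    fun i => ⌊z.2 i / 2 ^ n + (if θ.2 i then (-1) ^ n / 3 else 0)⌋)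

lemma gCell_measurable (d : ℕ) (θ : Bool × (Fin d → Bool)) (n : ℤ) :
    Measurable (gCell d θ n) := by
  unfold gCell
  refine Measurable.prodMk ?_ ?_
  · exact Int.measurable_floor.comp (by fun_prop)
  · refine measurable_pi_lambda _ fun i => ?_
    exact Int.measurable_floor.comp (by fun_prop)

lemma floor_half (k : ℕ) (m : ℤ) (u v : ℝ) (h : ⌊u⌋ = ⌊v⌋) : ⌊(u + m) / k⌋ = ⌊(v + m) / k⌋ := by
  rw [Int.floor_div_natCast, Int.floor_div_natCast, Int.floor_add_intCast, Int.floor_add_intCast, h]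

lemma gCell_nested (d : ℕ) (θ : Bool × (Fin d → Bool)) (n : ℤ) (x y : Pt d)
    (h : gCell d θ n x = gCell d θ n y) : gCell d θ (n + 1) x = gCell d θ (n + 1) y := by
  unfold gCell at *
  simp only [Prod.mk.injEq] at h ⊢
  obtain ⟨h1, h2⟩ := h
  constructor
  · have key := floor_half 4 (if θ.1 then 1 else 0) _ _ h1
    convert key using 2
    · rw [zpow_add₀ (by norm_num)]; split_ifs <;> (push_cast; field_simp; ring)
    · rw [zpow_add₀ (by norm_num)]; split_ifs <;> (push_cast; field_simp; ring)
  · funext i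
    have h2 := congrFun h2 i
    have hm : ∃ m : ℤ, (m : ℝ) = (-1) ^ n := by
      rcases Int.even_or_odd n with h | h
      · exact ⟨1, by rw [h.neg_one_zpow]; simp⟩
      · exact ⟨-1, by rw [h.neg_one_zpow]; simp⟩
    obtain ⟨m, hm⟩ := hm
    have key := floor_half 2 (if θ.2 i then -m else 0) _ _ h2
    rw [← hm] at key
    rw [zpow_add₀ (by norm_num), zpow_add₀ (by norm_num), ← hm]
    convert key using 2
    · split_ifs <;> (push_cast; field_simp; ring)
    · split_ifs <;> (push_cast; field_simp; ring)

lemma floor_third (u v e : ℝ) (he : e = 1 ∨ e = -1) (h : |u - v| < 1 / 3) :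
    ⌊u⌋ = ⌊v⌋ ∨ ⌊u + e / 3⌋ = ⌊v + e / 3⌋ := by
  by_contra! hcon
  obtain ⟨h1, h2⟩ := hcon
  obtain ⟨ha, hb⟩ := abs_lt.1 h
  have a1 := Int.floor_le u
  have a2 := Int.lt_floor_add_one u
  have a3 := Int.floor_le v
  have a4 := Int.lt_floor_add_one v
  have b1 := Int.floor_le (u + e/3)
  have b2 := Int.lt_floor_add_one (u + e/3)
  have b3 := Int.floor_le (v + e/3)
  have b4 := Int.lt_floor_add_one (v + e/3)
  generalize ⌊u⌋ = A at *
  generalize ⌊v⌋ = B at *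
  generalize ⌊u + e/3⌋ = C at *
  generalize ⌊v + e/3⌋ = D at *
  rcases lt_or_gt_of_ne h1 with h1 | h1 <;> rcases lt_or_gt_of_ne h2 with h2 | h2
  · have h1' : (A:ℝ) + 1 ≤ B := by exact_mod_cast h1
    have h2' : (C:ℝ) + 1 ≤ D := by exact_mod_cast h2
    -- A+1 ≤ B ≤ v, u < A+1
    have hBD : (B:ℤ) - 1 < D ∧ D < B + 1 := by
      rcases he with rfl | rfl
      · constructor
        · have : (B:ℝ) - 1 < D := by linarith
          exact_mod_cast this
        · have : (D:ℝ) < B + 1 := by linarith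
          exact_mod_cast this
      · constructor
        · have : (B:ℝ) - 1 < D := by linarith
          exact_mod_cast this
        · have : (D:ℝ) < B + 1 := by linarith
          exact_mod_cast this
    have : D = B := by omega
    subst this
    rcases he with rfl | rfl <;> linarith
  · have h1' : (A:ℝ) + 1 ≤ B := by exact_mod_cast h1
    have h2' : (D:ℝ) + 1 ≤ C := by exact_mod_cast h2
    linarith
  · have h1' : (B:ℝ) + 1 ≤ A := by exact_mod_cast h1
    have h2' : (C:ℝ) + 1 ≤ D := by exact_mod_cast h2
    linarith
  · have h1' : (B:ℝ) + 1 ≤ A := by exact_mod_cast h1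
    have h2' : (D:ℝ) + 1 ≤ C := by exact_mod_cast h2
    have hBD : (A:ℤ) - 1 < C ∧ C < A + 1 := by
      rcases he with rfl | rfl
      · constructor
        · have : (A:ℝ) - 1 < C := by linarith
          exact_mod_cast this
        · have : (C:ℝ) < A + 1 := by linarith
          exact_mod_cast this
      · constructor
        · have : (A:ℝ) - 1 < C := by linarith
          exact_mod_cast this
        · have : (C:ℝ) < A + 1 := by linarith
          exact_mod_cast this
    have : C = A := by omega
    subst this
    rcases he with rfl | rfl <;> linarith

lemma gCell_exists (d : ℕ) (n : ℤ) (x y : Pt d) (h1 : |x.1 - y.1| < 4 ^ n / 3)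
    (h2 : ∀ i, |x.2 i - y.2 i| < 2 ^ n / 3) : ∃ θ, gCell d θ n x = gCell d θ n y := by
  have k1 := floor_third (x.1 / 4 ^ n) (y.1 / 4 ^ n) 1 (Or.inl rfl) (by
    rw [← sub_div, abs_div, abs_of_pos (by positivity : (0:ℝ) < 4 ^ n), div_lt_iff₀ (by positivity)]
    linarith)
  have k2 : ∀ i, ⌊x.2 i / 2 ^ n⌋ = ⌊y.2 i / 2 ^ n⌋ ∨
      ⌊x.2 i / 2 ^ n + (-1) ^ n / 3⌋ = ⌊y.2 i / 2 ^ n + (-1) ^ n / 3⌋ := by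
    intro i
    refine floor_third _ _ ((-1)^n) ?_ ?_
    · rcases Int.even_or_odd n with h | h
      · left; rw [h.neg_one_zpow]
      · right; rw [h.neg_one_zpow]
    · rw [← sub_div, abs_div, abs_of_pos (by positivity : (0:ℝ) < 2 ^ n),
        div_lt_iff₀ (by positivity)]
      linarith [h2 i]
  have e1 : ∃ t : Bool, ⌊x.1 / 4 ^ n + (if t then 1 / 3 else 0)⌋ =
      ⌊y.1 / 4 ^ n + (if t then 1 / 3 else 0)⌋ := by
    rcases k1 with h | h
    · exact ⟨false, by simpa using h⟩
    · exact ⟨true, by simpa using h⟩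
  have e2 : ∀ i, ∃ t : Bool, ⌊x.2 i / 2 ^ n + (if t then (-1) ^ n / 3 else 0)⌋ =
      ⌊y.2 i / 2 ^ n + (if t then (-1) ^ n / 3 else 0)⌋ := by
    intro i
    rcases k2 i with h | h
    · exact ⟨false, by simpa using h⟩
    · exact ⟨true, by simpa using h⟩
  obtain ⟨t, ht⟩ := e1
  choose s hs using e2
  exact ⟨(t, s), by unfold gCell; exact Prod.ext ht (funext hs)⟩

lemma floor_fiber (a s : ℝ) (ha : 0 < a) (k : ℤ) (x : ℝ) :
    ⌊x / a + s⌋ = k ↔ x ∈ Ico (a * (k - s)) (a * (k - s) + a) := by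
  rw [Int.floor_eq_iff, mem_Ico]
  constructor
  · rintro ⟨h1, h2⟩
    constructor
    · have : (k:ℝ) - s ≤ x / a := by linarith
      rw [le_div_iff₀ ha] at this; linarith
    · have : x / a < (k:ℝ) - s + 1 := by linarith
      rw [div_lt_iff₀ ha] at this; linarith
  · rintro ⟨h1, h2⟩
    constructor
    · have : (k:ℝ) - s ≤ x / a := by rw [le_div_iff₀ ha]; linarith
      linarith
    · have : x / a < (k:ℝ) - s + 1 := by rw [div_lt_iff₀ ha]; linarith
      linarith

/-- lower corner of a cell -/
def gCorner (d : ℕ) (θ : Bool × (Fin d → Bool)) (n : ℤ) (k : ℤ × (Fin d → ℤ)) : Pt d :=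
  ((4:ℝ) ^ n * (k.1 - (if θ.1 then 1 / 3 else 0)),
    WithLp.toLp 2 fun i => (2:ℝ) ^ n * (k.2 i - (if θ.2 i then (-1) ^ n / 3 else 0)))

lemma gCell_mem (d : ℕ) (θ : Bool × (Fin d → Bool)) (n : ℤ) (k : ℤ × (Fin d → ℤ)) (y : Pt d) :
    gCell d θ n y = k ↔ y.1 ∈ Ico (gCorner d θ n k).1 ((gCorner d θ n k).1 + 4 ^ n) ∧
      ∀ i, y.2 i ∈ Ico ((gCorner d θ n k).2 i) ((gCorner d θ n k).2 i + 2 ^ n) := by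
  unfold gCell gCorner
  rw [Prod.ext_iff, funext_iff]
  simp only
  rw [floor_fiber _ _ (by positivity)]
  refine and_congr Iff.rfl (forall_congr' fun i => ?_)
  rw [floor_fiber _ _ (by positivity)]

lemma gCell_volume (d : ℕ) (θ : Bool × (Fin d → Bool)) (n : ℤ) (k : ℤ × (Fin d → ℤ)) :
    volume (gCell d θ n ⁻¹' {k}) = ENNReal.ofReal ((2 ^ n) ^ (d + 2)) := by
  have e : gCell d θ n ⁻¹' {k} = Ico (gCorner d θ n k).1 ((gCorner d θ n k).1 + 4 ^ n) ×ˢ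
      ((WithLp.ofLp : Ed d → (Fin d → ℝ)) ⁻¹' (univ.pi fun i =>
        Ico ((gCorner d θ n k).2 i) ((gCorner d θ n k).2 i + 2 ^ n))) := by
    ext y
    rw [mem_preimage, mem_singleton_iff, gCell_mem, mem_prod]
    simp
  rw [e, Measure.volume_eq_prod, Measure.prod_prod, Real.volume_Ico,
    (PiLp.volume_preserving_ofLp (Fin d)).measure_preimage
      (MeasurableSet.univ_pi fun i => measurableSet_Ico).nullMeasurableSet, Real.volume_pi_Ico]
  simp only [add_sub_cancel_left, Finset.prod_const, Finset.card_univ, Fintype.card_fin]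
  rw [← ENNReal.ofReal_pow (by positivity), ← ENNReal.ofReal_mul (by positivity)]
  congr 1
  have : (4:ℝ) ^ n = (2 ^ n) ^ 2 := by
    rw [← zpow_natCast, ← zpow_mul, mul_comm, zpow_mul]; norm_num
  rw [this]; ring

lemma pCyl_eq (d : ℕ) (ρ : ℝ) (z : Pt d) :
    pCyl d ρ z = Ico z.1 (z.1 + ρ ^ 2) ×ˢ Metric.ball z.2 ρ := by
  ext w
  simp only [pCyl, mem_prod, mem_Ico, Metric.mem_ball]
  rw [dist_comm]
  exact and_comm

lemma pCyl_volume (d : ℕ) (ρ : ℝ) (hρ : 0 < ρ) (z : Pt d) :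
    volume (pCyl d ρ z) = ENNReal.ofReal (ρ ^ (d + 2)) * volume (Metric.ball (0 : Ed d) 1) := by
  rw [pCyl_eq, Measure.volume_eq_prod, Measure.prod_prod, Real.volume_Ico,
    Measure.addHaar_ball_of_pos _ _ hρ, ← mul_assoc, ← ENNReal.ofReal_mul]
  · congr 2
    rw [add_sub_cancel_left, finrank_euclideanSpace, Fintype.card_fin]; ring
  · rw [add_sub_cancel_left]; positivity

lemma gCell_sub (d : ℕ) (θ : Bool × (Fin d → Bool)) (n : ℤ) (k : ℤ × (Fin d → ℤ)) :
    gCell d θ n ⁻¹' {k} ⊆ pCyl d ((d + 1) * 2 ^ n) (gCorner d θ n k) := by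
  intro y hy
  rw [mem_preimage, mem_singleton_iff, gCell_mem] at hy
  obtain ⟨h1, h2⟩ := hy
  have h2n : (0:ℝ) < 2 ^ n := by positivity
  have h4 : (4:ℝ) ^ n = (2 ^ n) ^ 2 := by
    rw [← zpow_natCast, ← zpow_mul, mul_comm, zpow_mul]; norm_num
  have hd : (0:ℝ) ≤ d := Nat.cast_nonneg d
  refine ⟨?_, h1.1, lt_of_lt_of_le h1.2 ?_⟩
  · rw [EuclideanSpace.dist_eq, Real.sqrt_lt' (by positivity)]
    calc ∑ i, dist ((gCorner d θ n k).2 i) (y.2 i) ^ 2 ≤ ∑ i : Fin d, ((2:ℝ) ^ n) ^ 2 := by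
          refine Finset.sum_le_sum fun i _ => ?_
          rw [Real.dist_eq, sq_abs]
          have := h2 i
          have h3 := this.1
          have h4 := this.2
          nlinarith
      _ = d * ((2:ℝ) ^ n) ^ 2 := by simp
      _ < _ := by
          rw [mul_pow]
          have : (0:ℝ) < (2 ^ n) ^ 2 := by positivity
          exact mul_lt_mul_of_pos_right (by nlinarith) this
  · rw [h4, mul_pow]
    have : (0:ℝ) < (2 ^ n) ^ 2 := by positivity
    have h5 : (1:ℝ) * (2 ^ n) ^ 2 ≤ (d + 1) ^ 2 * (2 ^ n) ^ 2 :=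
      mul_le_mul_of_nonneg_right (by nlinarith) this.le
    linarith

lemma morrey_cell (d : ℕ) (q : ℝ) (hq : 0 < q) : ∃ κ : ℝ≥0∞, κ ≠ ⊤ ∧
    ∀ (b : Pt d → ℝ≥0∞) (θ : Bool × (Fin d → Bool)) (n : ℤ) (k : ℤ × (Fin d → ℤ)),
    ENNReal.ofReal (2 ^ n) * (∫⁻ y in gCell d θ n ⁻¹' {k}, b y ^ q) ^ (1 / q)
      ≤ κ * MorreyNorm d q 1 univ b * volume (gCell d θ n ⁻¹' {k}) ^ (1 / q) := by
  set V := volume (Metric.ball (0 : Ed d) 1) with hV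
  have hVt : V ≠ ⊤ := measure_ball_lt_top.ne
  have hV0 : V ≠ 0 := (Metric.measure_ball_pos _ _ one_pos).ne'
  refine ⟨(ENNReal.ofReal ((d + 1) ^ (d + 2)) * V) ^ (1/q), ?_, ?_⟩
  · exact ENNReal.rpow_ne_top_of_nonneg (by positivity) (ENNReal.mul_ne_top ofReal_ne_top hVt)
  intro b θ n k
  set ρ : ℝ := (d + 1) * 2 ^ n with hρ
  have hρ0 : 0 < ρ := by positivity
  set w := gCorner d θ n k
  set Q := gCell d θ n ⁻¹' {k} with hQ
  have hC : volume (pCyl d ρ w) = (ENNReal.ofReal ((d + 1) ^ (d + 2)) * V) * volume Q := by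
    rw [pCyl_volume d ρ hρ0, hQ, gCell_volume, hρ, mul_pow, ENNReal.ofReal_mul (by positivity)]
    ring
  have hCt : volume (pCyl d ρ w) ≠ ⊤ := by
    rw [pCyl_volume d ρ hρ0]; exact ENNReal.mul_ne_top ofReal_ne_top hVt
  have hC0 : volume (pCyl d ρ w) ≠ 0 := by
    rw [pCyl_volume d ρ hρ0]
    exact mul_ne_zero (ENNReal.ofReal_pos.2 (by positivity)).ne' hV0
  have hM : ENNReal.ofReal (ρ ^ (1:ℝ)) * (pAvg d ρ w fun w => (univ : Set (Pt d)).indicator b w ^ q) ^ (1 / q)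
      ≤ MorreyNorm d q 1 univ b := by
    unfold MorreyNorm
    exact le_iSup_of_le ρ (le_iSup_of_le hρ0 (le_iSup_of_le w (le_iSup_of_le (mem_univ _) le_rfl)))
  simp only [indicator_univ, Real.rpow_one, pAvg] at hM
  calc ENNReal.ofReal (2 ^ n) * (∫⁻ y in Q, b y ^ q) ^ (1 / q)
      ≤ ENNReal.ofReal ρ * (∫⁻ y in pCyl d ρ w, b y ^ q) ^ (1 / q) := by
        refine mul_le_mul' (ENNReal.ofReal_le_ofReal ?_) (ENNReal.rpow_le_rpow ?_ (by positivity))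
        · rw [hρ]
          have : (0:ℝ) < 2 ^ n := by positivity
          have hd : (0:ℝ) ≤ d := Nat.cast_nonneg d
          nlinarith
        · exact lintegral_mono_set (gCell_sub d θ n k)
    _ = (ENNReal.ofReal ρ * ((volume (pCyl d ρ w))⁻¹ * ∫⁻ y in pCyl d ρ w, b y ^ q) ^ (1 / q)) *
          volume (pCyl d ρ w) ^ (1/q) := by
        rw [mul_assoc, ← ENNReal.mul_rpow_of_nonneg _ _ (by positivity : 0 ≤ 1/q), mul_right_comm,
          ENNReal.inv_mul_cancel hC0 hCt, one_mul]
    _ ≤ MorreyNorm d q 1 univ b * volume (pCyl d ρ w) ^ (1/q) := mul_le_mul_left hM _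
    _ = _ := by
        rw [hC, ENNReal.mul_rpow_of_nonneg _ _ (by positivity : 0 ≤ 1/q)]; ring
lemma ker_real (d : ℕ) (s r : ℝ) (hs : 0 < s) (hr : 0 ≤ r) :
    ∃ n : ℤ, s < 4 ^ n / 3 ∧ r < 2 ^ n / 3 ∧
      s ^ (-(((d : ℝ) + 2 - 1) / 2)) * Real.exp (-(r ^ 2) / s)
        ≤ ((d + 1).factorial * 6 ^ (d + 1)) * ((2 ^ n) ^ (d + 1))⁻¹ := by
  set σ := Real.sqrt s with hσ
  have hσ0 : 0 < σ := Real.sqrt_pos.2 hs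
  have hσs : σ ^ 2 = s := Real.sq_sqrt hs.le
  have hpow : s ^ (-(((d : ℝ) + 2 - 1) / 2)) = (σ ^ (d + 1))⁻¹ := by
    rw [← hσs, ← Real.rpow_natCast σ 2, ← Real.rpow_mul hσ0.le, ← Real.rpow_natCast σ (d+1),
      ← Real.rpow_neg hσ0.le]
    congr 1
    push_cast; ring
  set m := max σ r with hm
  have hm0 : 0 < m := lt_of_lt_of_le hσ0 (le_max_left _ _)
  obtain ⟨k, hk1, hk2⟩ := exists_mem_Ico_zpow (x := 3 * m) (y := (2:ℝ)) (by positivity) (by norm_num)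
  have h4 : (4:ℝ) ^ (k + 1) = (2 ^ (k + 1)) ^ 2 := by
    rw [← zpow_natCast, ← zpow_mul, mul_comm, zpow_mul]; norm_num
  have hf1 : (1:ℝ) ≤ (d+1).factorial := by exact_mod_cast Nat.one_le_iff_ne_zero.2 (Nat.factorial_ne_zero _)
  have hmain : (σ ^ (d + 1))⁻¹ * Real.exp (-(r ^ 2) / s) ≤ (d+1).factorial * (m ^ (d + 1))⁻¹ := by
    have hexp : Real.exp (-(r ^ 2) / s) ≤ 1 := by
      rw [Real.exp_le_one_iff]
      exact div_nonpos_of_nonpos_of_nonneg (by nlinarith) hs.le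
    rcases le_total r σ with h | h
    · rw [hm, max_eq_left h]
      have : 0 < (σ ^ (d + 1))⁻¹ := by positivity
      nlinarith
    · rw [hm, max_eq_right h]
      have hr0 : 0 < r := lt_of_lt_of_le hσ0 h
      set v := r / σ with hv
      have hv1 : 1 ≤ v := by rw [hv, one_le_div hσ0]; exact h
      have e1 : -(r ^ 2) / s = -(v ^ 2) := by rw [hv, div_pow, hσs, neg_div]
      have e2 : v ^ (d + 1) ≤ (d+1).factorial * Real.exp (v ^ 2) := by
        have h1 := Real.pow_div_factorial_le_exp v (by linarith) (d + 1)
        rw [div_le_iff₀ (by positivity)] at h1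
        have h2 : Real.exp v ≤ Real.exp (v ^ 2) := Real.exp_le_exp.2 (by nlinarith)
        nlinarith
      rw [e1, Real.exp_neg, ← mul_inv, ← div_eq_mul_inv, le_div_iff₀ (by positivity),
        inv_mul_le_iff₀ (by positivity)]
      have e3 : r ^ (d + 1) = σ ^ (d + 1) * v ^ (d + 1) := by
        rw [hv, div_pow]; field_simp
      rw [e3]
      have : 0 < σ ^ (d+1) := by positivity
      nlinarith
  refine ⟨k + 1, ?_, ?_, ?_⟩
  · have h1 : σ ≤ m := le_max_left _ _
    rw [h4, ← hσs]
    nlinarith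
  · have h1 : r ≤ m := le_max_right _ _
    linarith
  · rw [hpow]
    refine hmain.trans ?_
    rw [mul_assoc]
    refine mul_le_mul_of_nonneg_left ?_ (by positivity)
    rw [inv_le_iff_one_le_mul₀ (by positivity)]
    have h6 : (2:ℝ) ^ (k+1) ≤ 6 * m := by rw [zpow_add₀ (by norm_num), zpow_one]; linarith
    have h7 : ((2:ℝ) ^ (k+1)) ^ (d+1) ≤ 6 ^ (d+1) * m ^ (d+1) := by
      rw [← mul_pow]; gcongr
    have h8 : (0:ℝ) < (2 ^ (k+1)) ^ (d+1) := by positivity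
    calc (1:ℝ) = ((2 ^ (k+1)) ^ (d+1)) * ((2 ^ (k+1)) ^ (d+1))⁻¹ := (mul_inv_cancel₀ h8.ne').symm
      _ ≤ (6 ^ (d+1) * m ^ (d+1)) * ((2 ^ (k+1)) ^ (d+1))⁻¹ := by gcongr
      _ = _ := by ring

/-- average over grid cell -/
def gAv (d : ℕ) (θ : Bool × (Fin d → Bool)) (n : ℤ) (f : Pt d → ℝ≥0∞) (z : Pt d) : ℝ≥0∞ :=
  (volume (gCell d θ n ⁻¹' {gCell d θ n z}))⁻¹ * ∫⁻ y in gCell d θ n ⁻¹' {gCell d θ n z}, f y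

lemma ker_bound (d : ℕ) (z w : Pt d) : pKer d 1 w.1 ‖w.2‖ ≤
    ENNReal.ofReal ((d + 1).factorial * 6 ^ (d + 1)) * ∑ θ : Bool × (Fin d → Bool), ∑' n : ℤ,
      ENNReal.ofReal (2 ^ n) * ((volume (gCell d θ n ⁻¹' {gCell d θ n z}))⁻¹ *
        (gCell d θ n ⁻¹' {gCell d θ n z}).indicator 1 (z + w)) := by
  unfold pKer
  split_ifs with hs
  swap
  · exact zero_le
  obtain ⟨n, h1, h2, h3⟩ := ker_real d w.1 ‖w.2‖ hs (norm_nonneg _)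
  obtain ⟨θ, hθ⟩ := gCell_exists d n (z + w) z
    (by simpa [abs_of_pos hs] using h1)
    (by
      intro i
      have : |w.2 i| ≤ ‖w.2‖ := by simpa using PiLp.norm_apply_le w.2 i
      simpa using lt_of_le_of_lt this h2)
  calc _ ≤ ENNReal.ofReal (((d + 1).factorial * 6 ^ (d + 1)) * ((2 ^ n) ^ (d + 1))⁻¹) :=
        ENNReal.ofReal_le_ofReal h3
    _ = ENNReal.ofReal ((d + 1).factorial * 6 ^ (d + 1)) *
          (ENNReal.ofReal (2 ^ n) * ((volume (gCell d θ n ⁻¹' {gCell d θ n z}))⁻¹ *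
        (gCell d θ n ⁻¹' {gCell d θ n z}).indicator 1 (z + w))) := by
        rw [indicator_of_mem (by exact hθ), gCell_volume, ENNReal.ofReal_mul (by positivity)]
        congr 1
        rw [Pi.one_apply, mul_one, ← ENNReal.ofReal_inv_of_pos (by positivity),
          ← ENNReal.ofReal_mul (by positivity)]
        congr 1
        field_simp
        ring
    _ ≤ _ := by
        refine mul_le_mul_right ?_ _
        refine le_trans ?_ (Finset.single_le_sum (fun _ _ => zero_le) (Finset.mem_univ θ))
        exact ENNReal.le_tsum (f := fun n : ℤ => ENNReal.ofReal (2 ^ n) *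
          ((volume (gCell d θ n ⁻¹' {gCell d θ n z}))⁻¹ *
          (gCell d θ n ⁻¹' {gCell d θ n z}).indicator 1 (z + w))) n

lemma gCell_ms (d : ℕ) (θ : Bool × (Fin d → Bool)) (n : ℤ) (k : ℤ × (Fin d → ℤ)) :
    MeasurableSet (gCell d θ n ⁻¹' {k}) := gCell_measurable d θ n (measurableSet_singleton k)

lemma Palpha_le (d : ℕ) (f : Pt d → ℝ≥0∞) (hf : Measurable f) (z : Pt d) : Palpha d 1 f z ≤
    ENNReal.ofReal ((d + 1).factorial * 6 ^ (d + 1)) * ∑ θ : Bool × (Fin d → Bool), ∑' n : ℤ,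
      ENNReal.ofReal (2 ^ n) * gAv d θ n f z := by
  have hind : ∀ θ (n : ℤ), Measurable fun y : Pt d =>
      (gCell d θ n ⁻¹' {gCell d θ n z}).indicator f y := fun θ n => hf.indicator (gCell_ms d θ n _)
  unfold Palpha
  calc _ ≤ ∫⁻ w : Pt d, (fun y => ENNReal.ofReal ((d + 1).factorial * 6 ^ (d + 1)) *
          ∑ θ : Bool × (Fin d → Bool), ∑' n : ℤ,
          ENNReal.ofReal (2 ^ n) * ((volume (gCell d θ n ⁻¹' {gCell d θ n z}))⁻¹ *
        (gCell d θ n ⁻¹' {gCell d θ n z}).indicator f y)) (z + w) := by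
        refine lintegral_mono fun w => ?_
        have e : ((z.1 + w.1, z.2 + w.2) : Pt d) = z + w := rfl
        simp only [e]
        refine (mul_le_mul_left (ker_bound d z w) _).trans (le_of_eq ?_)
        rw [mul_assoc, Finset.sum_mul]
        congr 1
        refine Finset.sum_congr rfl fun θ _ => ?_
        rw [← ENNReal.tsum_mul_right]
        refine tsum_congr fun n => ?_
        rw [mul_assoc, mul_assoc]
        congr 2
        by_cases h : z + w ∈ gCell d θ n ⁻¹' {gCell d θ n z}
        · rw [indicator_of_mem h, indicator_of_mem h]; simp
        · rw [indicator_of_notMem h, indicator_of_notMem h]; simp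
    _ = ∫⁻ y : Pt d, ENNReal.ofReal ((d + 1).factorial * 6 ^ (d + 1)) *
          ∑ θ : Bool × (Fin d → Bool), ∑' n : ℤ,
          ENNReal.ofReal (2 ^ n) * ((volume (gCell d θ n ⁻¹' {gCell d θ n z}))⁻¹ *
        (gCell d θ n ⁻¹' {gCell d θ n z}).indicator f y) := by
        have : (volume : Measure (Pt d)).IsAddLeftInvariant :=
          inferInstanceAs ((volume : Measure ℝ).prod
            (volume : Measure (EuclideanSpace ℝ (Fin d)))).IsAddLeftInvariant
        have key : ∀ g : Pt d → ℝ≥0∞, ∫⁻ w : Pt d, g (z + w) = ∫⁻ y : Pt d, g y :=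
          fun g => lintegral_add_left_eq_self (μ := (volume : Measure (Pt d))) g z
        exact key (fun y => ENNReal.ofReal ((d + 1).factorial * 6 ^ (d + 1)) *
          ∑ θ : Bool × (Fin d → Bool), ∑' n : ℤ,
          ENNReal.ofReal (2 ^ n) * ((volume (gCell d θ n ⁻¹' {gCell d θ n z}))⁻¹ *
          (gCell d θ n ⁻¹' {gCell d θ n z}).indicator f y))
    _ = _ := by
        rw [lintegral_const_mul' _ _ ofReal_ne_top, lintegral_finsetSum]
        · congr 1
          refine Finset.sum_congr rfl fun θ _ => ?_
          rw [lintegral_tsum]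
          · refine tsum_congr fun n => ?_
            rw [lintegral_const_mul' _ _ ofReal_ne_top, lintegral_const_mul _ (hind θ n),
              lintegral_indicator (gCell_ms d θ n _)]
            rfl
          · intro n
            exact (((hind θ n).const_mul _).const_mul _).aemeasurable
        · intro θ _
          exact Measurable.tsum fun n => ((hind θ n).const_mul _).const_mul _

lemma tsum_int_iSup (a : ℤ → ℝ≥0∞) : ∑' n, a n = ⨆ N : ℕ, ∑' j : ℕ, a (N - j) := by
  refine le_antisymm ?_ (iSup_le fun N => ?_)
  · rw [ENNReal.tsum_eq_iSup_sum]
    refine iSup_le fun s => ?_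
    obtain ⟨M, hM⟩ := s.bddAbove
    refine le_iSup_of_le M.toNat ?_
    have hM' : ∀ k ∈ s, k ≤ (M.toNat : ℤ) := fun k hk =>
      (hM (Finset.mem_coe.2 hk)).trans (Int.self_le_toNat M)
    calc ∑ k ∈ s, a k = ∑ j ∈ s.image (fun k => ((M.toNat : ℤ) - k).toNat), a ((M.toNat:ℤ) - j) := by
          rw [Finset.sum_image]
          · refine Finset.sum_congr rfl fun k hk => ?_
            congr 1
            have := hM' k hk
            omega
          · intro k hk l hl h
            have h1 := hM' k hk
            have h2 := hM' l hl
            simp only at h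
            omega
      _ ≤ _ := ENNReal.sum_le_tsum _
  · have hinj : Function.Injective (fun j : ℕ => (N:ℤ) - (j:ℤ)) := by
      intro a b h; simpa using h
    exact ENNReal.tsum_comp_le_tsum_of_injective hinj a

lemma tsum_int_mono (a : ℤ → ℝ≥0∞) : Monotone fun N : ℕ => ∑' j : ℕ, a (N - j) := by
  refine monotone_nat_of_le_succ fun N => ?_
  have hinj : Function.Injective (fun j : ℕ => j + 1) := add_left_injective 1
  refine le_trans (le_of_eq ?_)
    (ENNReal.tsum_comp_le_tsum_of_injective hinj fun j : ℕ => a (((N + 1 : ℕ) : ℤ) - j))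
  refine tsum_congr fun j => ?_
  congr 1
  push_cast; ring

lemma grid_trace (d : ℕ) (p q : ℝ) (hp : 1 < p) (hpq : p < q) : ∃ C : ℝ≥0∞, C ≠ ⊤ ∧
    ∀ (θ : Bool × (Fin d → Bool)) (b f : Pt d → ℝ≥0∞), Measurable b → Measurable f →
    ∫⁻ x, (b x * ∑' n : ℤ, ENNReal.ofReal (2 ^ n) * gAv d θ n f x) ^ p
      ≤ C * MorreyNorm d q 1 univ b ^ p * ∫⁻ x, f x ^ p := by
  have hp0 : 0 < p := by linarith
  obtain ⟨C, hC, hmain⟩ := dy_trace (X := Pt d) (ι := ℤ × (Fin d → ℤ)) p q hp hpq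
  obtain ⟨κ, hκ, hmor⟩ := morrey_cell d q (by linarith)
  refine ⟨C * κ ^ p, ENNReal.mul_ne_top hC (ENNReal.rpow_ne_top_of_nonneg hp0.le hκ), ?_⟩
  intro θ b f hb hf
  have hAm : ∀ n : ℤ, Measurable (gAv d θ n f) := fun n =>
    dyAv_measurable volume (fun _ => gCell d θ n) (fun _ => gCell_measurable d θ n) 0 f
  have step : ∀ N : ℕ, ∫⁻ x, (b x * ∑' j : ℕ, ENNReal.ofReal (2 ^ ((N:ℤ) - j)) *
      gAv d θ ((N:ℤ) - j) f x) ^ p ≤ C * κ ^ p * MorreyNorm d q 1 univ b ^ p * ∫⁻ x, f x ^ p := by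
    intro N
    have := hmain volume inferInstance (fun j => gCell d θ ((N:ℤ) - j))
      (fun j => gCell_measurable d θ _)
      (by
        intro j x y h
        have := gCell_nested d θ _ x y h
        have e : (N:ℤ) - ((j + 1 : ℕ) : ℤ) + 1 = N - j := by push_cast; ring
        rwa [e] at this)
      (by intro j x; rw [gCell_volume]; exact (ENNReal.ofReal_pos.2 (by positivity)).ne')
      (by intro j x; rw [gCell_volume]; exact ofReal_ne_top)
      (fun j => ENNReal.ofReal (2 ^ ((N:ℤ) - j)))
      (by
        intro j0
        have e : ∀ j : ℕ, ENNReal.ofReal (2 ^ ((N:ℤ) - ((j0 + j : ℕ) : ℤ))) =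
            ENNReal.ofReal (2 ^ ((N:ℤ) - j0)) * (2⁻¹ : ℝ≥0∞) ^ j := by
          intro j
          have h2 : (2⁻¹ : ℝ≥0∞) = ENNReal.ofReal (2⁻¹) := by
            rw [ENNReal.ofReal_inv_of_pos (by norm_num)]; simp
          rw [h2, ← ENNReal.ofReal_pow (by norm_num), ← ENNReal.ofReal_mul (by positivity)]
          congr 1
          rw [inv_pow, ← zpow_natCast, ← zpow_neg, ← zpow_add₀ (by norm_num)]
          congr 1
          push_cast; ring
        simp only [e]
        rw [ENNReal.tsum_mul_left, ENNReal.tsum_geometric, mul_comm]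
        simp)
      b f hb hf (κ * MorreyNorm d q 1 univ b)
      (fun j x => hmor b θ _ _)
    refine this.trans (le_of_eq ?_)
    rw [ENNReal.mul_rpow_of_nonneg _ _ hp0.le]
    ring
  calc ∫⁻ x, (b x * ∑' n : ℤ, ENNReal.ofReal (2 ^ n) * gAv d θ n f x) ^ p
      = ∫⁻ x, ⨆ N : ℕ, (b x * ∑' j : ℕ, ENNReal.ofReal (2 ^ ((N:ℤ) - j)) *
      gAv d θ ((N:ℤ) - j) f x) ^ p := by
        refine lintegral_congr fun x => ?_
        rw [tsum_int_iSup, ENNReal.mul_iSup]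
        exact (ENNReal.orderIsoRpow p hp0).map_iSup _
    _ = ⨆ N : ℕ, ∫⁻ x, (b x * ∑' j : ℕ, ENNReal.ofReal (2 ^ ((N:ℤ) - j)) *
      gAv d θ ((N:ℤ) - j) f x) ^ p := by
        refine lintegral_iSup (fun N => ?_) ?_
        · exact (hb.mul (Measurable.tsum fun j => (hAm _).const_mul _)).pow_const _
        · intro N M hNM x
          refine ENNReal.rpow_le_rpow (mul_le_mul_right ?_ _) hp0.le
          exact tsum_int_mono (fun n => ENNReal.ofReal (2 ^ n) * gAv d θ n f x) hNM
    _ ≤ _ := iSup_le step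

/-- Theorem 4.1, (4.1): for `d+2 ≥ q > p > 1` there is `N = N(d,p,q)` such
that `∫ |b|^p (P_1 f)^p dz ≤ N ‖b‖_{E_{q,1}}^p ‖f‖_{L_p}^p`. -/
theorem stmt12 (d : ℕ) (hd : 1 ≤ d) (p q : ℝ) (hp : 1 < p) (hpq : p < q)
    (hq : q ≤ (d : ℝ) + 2) :
    ∃ N : ℝ, 0 < N ∧ ∀ b : Pt d → ℝ, Measurable b →
      MorreyNorm d q 1 univ (fun z => ENNReal.ofReal |b z|) ≠ ⊤ →
      ∀ f : Pt d → ℝ≥0∞, Measurable f →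
        ∫⁻ z : Pt d, ENNReal.ofReal |b z| ^ p * Palpha d 1 f z ^ p ≤
          ENNReal.ofReal N * MorreyNorm d q 1 univ (fun z => ENNReal.ofReal |b z|) ^ p *
            LpNormE d p f ^ p := by
  have hp0 : 0 < p := by linarith
  obtain ⟨C, hC, hmain⟩ := grid_trace d p q hp hpq
  set A : ℝ≥0∞ := ENNReal.ofReal ((d + 1).factorial * 6 ^ (d + 1)) with hA
  set n0 : ℝ≥0∞ := ((Finset.univ : Finset (Bool × (Fin d → Bool))).card : ℝ≥0∞) with hn0
  set K : ℝ≥0∞ := A ^ p * (n0 ^ (p - 1) * (n0 * C)) with hK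
  have hKt : K ≠ ⊤ := by
    refine ENNReal.mul_ne_top (ENNReal.rpow_ne_top_of_nonneg hp0.le ofReal_ne_top) ?_
    refine ENNReal.mul_ne_top (ENNReal.rpow_ne_top_of_nonneg (by linarith) ?_) ?_
    · exact ENNReal.natCast_ne_top _
    · exact ENNReal.mul_ne_top (ENNReal.natCast_ne_top _) hC
  refine ⟨K.toReal + 1, by positivity, ?_⟩
  intro b hb _ f hf
  set b' : Pt d → ℝ≥0∞ := fun z => ENNReal.ofReal |b z| with hb'
  have hb'm : Measurable b' := hb.abs.ennreal_ofReal
  have hAm : ∀ θ (n : ℤ), Measurable (gAv d θ n f) := fun θ n =>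
    dyAv_measurable volume (fun _ => gCell d θ n) (fun _ => gCell_measurable d θ n) 0 f
  have hLp : LpNormE d p f ^ p = ∫⁻ z : Pt d, f z ^ p := by
    unfold LpNormE
    rw [← ENNReal.rpow_mul, one_div_mul_cancel hp0.ne', ENNReal.rpow_one]
  have hKN : K ≤ ENNReal.ofReal (K.toReal + 1) := by
    conv_lhs => rw [← ENNReal.ofReal_toReal hKt]
    exact ENNReal.ofReal_le_ofReal (by linarith)
  rw [hLp]
  calc ∫⁻ z : Pt d, b' z ^ p * Palpha d 1 f z ^ p
      ≤ ∫⁻ z : Pt d, A ^ p * (n0 ^ (p - 1) * ∑ θ : Bool × (Fin d → Bool),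
          (b' z * ∑' n : ℤ, ENNReal.ofReal (2 ^ n) * gAv d θ n f z) ^ p) := by
        refine lintegral_mono fun z => ?_
        calc b' z ^ p * Palpha d 1 f z ^ p = (b' z * Palpha d 1 f z) ^ p := by
              rw [ENNReal.mul_rpow_of_nonneg _ _ hp0.le]
          _ ≤ (A * ∑ θ : Bool × (Fin d → Bool),
              b' z * ∑' n : ℤ, ENNReal.ofReal (2 ^ n) * gAv d θ n f z) ^ p := by
              refine ENNReal.rpow_le_rpow ?_ hp0.le
              refine (mul_le_mul_right (Palpha_le d f hf z) _).trans (le_of_eq ?_)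
              rw [← Finset.mul_sum]; ring
          _ ≤ _ := by
              rw [ENNReal.mul_rpow_of_nonneg _ _ hp0.le]
              exact mul_le_mul_right (ENNReal.rpow_sum_le_const_mul_sum_rpow _ _ hp.le) _
    _ = A ^ p * (n0 ^ (p - 1) * ∑ θ : Bool × (Fin d → Bool),
          ∫⁻ z : Pt d, (b' z * ∑' n : ℤ, ENNReal.ofReal (2 ^ n) * gAv d θ n f z) ^ p) := by
        rw [lintegral_const_mul' _ _ (ENNReal.rpow_ne_top_of_nonneg hp0.le ofReal_ne_top),
          lintegral_const_mul' _ _ (ENNReal.rpow_ne_top_of_nonneg (by linarith)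
            (ENNReal.natCast_ne_top _)), lintegral_finsetSum]
        intro θ _
        exact (hb'm.mul (Measurable.tsum fun n => (hAm θ n).const_mul _)).pow_const _
    _ ≤ A ^ p * (n0 ^ (p - 1) * ∑ θ : Bool × (Fin d → Bool),
          C * MorreyNorm d q 1 univ b' ^ p * ∫⁻ z : Pt d, f z ^ p) := by
        refine mul_le_mul_right (mul_le_mul_right ?_ _) _
        exact Finset.sum_le_sum fun θ _ => hmain θ b' f hb'm hf
    _ = K * MorreyNorm d q 1 univ b' ^ p * ∫⁻ z : Pt d, f z ^ p := by
        rw [Finset.sum_const, nsmul_eq_mul, hK]; ring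
    _ ≤ _ := by gcongr
end
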